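/- For every even positive integer L, the number of non-crossing partitions P of {1,…,L} that are fixed by the reflection τ(i) = L+1−i (i.e., τ·P = P) equals binom(L, L/2). -/

import Mathlib

open Finset

/-- A partition `P` of `{1,…,L}` (modeled as `Fin L`) is non-crossing if there are no
indices `a < b < c < d` with `a, c` in one block of `P` and `b, d` in a different block. -/
def NonCrossing {L : ℕ} (P : Finpartition (Finset.univ : Finset (Fin L))) : Prop :=
  ¬ ∃ a b c d : Fin L, a < b ∧ b < c ∧ c < d ∧
      ∃ B₁ ∈ P.parts, ∃ B₂ ∈ P.parts, B₁ ≠ B₂ ∧ a ∈ B₁ ∧ c ∈ B₁ ∧ b ∈ B₂ ∧ d ∈ B₂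

/-- The set of parts of the image of a partition under the reflection
`τ(i) = L+1−i` (on `Fin L`, `i ↦ L-1-i`, i.e. `Fin.rev`). -/
def reflParts {L : ℕ} (P : Finpartition (Finset.univ : Finset (Fin L))) :
    Finset (Finset (Fin L)) :=
  P.parts.image (fun B => B.image Fin.rev)

/-- `V` is a nonnegative walk with `m` steps `±1` starting at `0`, extended by zero after
time `m`. -/
def IsWalk (m : ℕ) (V : ℕ → ℕ) : Prop :=
  V 0 = 0 ∧ (∀ t < m, V (t + 1) = V t + 1 ∨ V (t + 1) + 1 = V t) ∧ ∀ t, m < t → V t = 0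

theorem IsWalk.update {m : ℕ} {V : ℕ → ℕ} (hV : IsWalk m V) {x : ℕ}
    (hx : x = V m + 1 ∨ x + 1 = V m) : IsWalk (m + 1) (Function.update V (m + 1) x) := by
  obtain ⟨h0, hs, hz⟩ := hV
  refine ⟨by simp [h0], fun t ht => ?_, fun t ht => ?_⟩
  · rcases Nat.lt_succ_iff_lt_or_eq.1 ht with h | rfl
    · have := hs t h
      rwa [Function.update_of_ne (by omega), Function.update_of_ne (by omega)]
    · rwa [Function.update_self, Function.update_of_ne (by omega)]
  · rw [Function.update_of_ne (by omega)]
    exact hz t (by omega)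

theorem IsWalk.restrict {m : ℕ} {V : ℕ → ℕ} (hV : IsWalk (m + 1) V) :
    IsWalk m (Function.update V (m + 1) 0) := by
  obtain ⟨h0, hs, hz⟩ := hV
  refine ⟨by simp [h0], fun t ht => ?_, fun t ht => ?_⟩
  · have := hs t (by omega)
    rwa [Function.update_of_ne (by omega), Function.update_of_ne (by omega)]
  · by_cases h : t = m + 1
    · simp [h]
    · rw [Function.update_of_ne h]
      exact hz t (by omega)

theorem injOn_update_isWalk (m : ℕ) (f : ℕ → ℕ) :
    Set.InjOn (fun V : ℕ → ℕ => Function.update V (m + 1) (f (V m))) {V | IsWalk m V} := by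
  intro V hV V' hV' h
  funext t
  by_cases ht : t = m + 1
  · rw [ht, hV.2.2 _ (by omega), hV'.2.2 _ (by omega)]
  · have := congrFun h t
    simpa [Function.update_of_ne ht] using this

theorem setOf_isWalk_succ (m h : ℕ) :
    {V | IsWalk (m + 1) V ∧ h ≤ V (m + 1)} =
      (fun V : ℕ → ℕ => Function.update V (m + 1) (V m + 1)) '' {V | IsWalk m V ∧ h - 1 ≤ V m} ∪
      (fun V : ℕ → ℕ => Function.update V (m + 1) (V m - 1)) ''
        {V | IsWalk m V ∧ h + 1 ≤ V m} := by
  ext V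
  constructor
  · rintro ⟨hV, hh⟩
    rcases hV.2.1 m (by omega) with h1 | h1
    · refine Or.inl ⟨_, ⟨hV.restrict, ?_⟩, ?_⟩
      · rw [Function.update_of_ne (by omega)]; omega
      · simp [← h1]
    · refine Or.inr ⟨_, ⟨hV.restrict, ?_⟩, ?_⟩
      · rw [Function.update_of_ne (by omega)]; omega
      · simp [← h1]
  · rintro (⟨V, ⟨hV, hh⟩, rfl⟩ | ⟨V, ⟨hV, hh⟩, rfl⟩)
    · exact ⟨hV.update (by omega), by simp; omega⟩
    · exact ⟨hV.update (by omega), by simp; omega⟩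

/-- The number of nonnegative walks of length `m` ending at height at least `h`. -/
theorem finite_and_ncard_isWalk (m h : ℕ) :
    {V | IsWalk m V ∧ h ≤ V m}.Finite ∧
      {V | IsWalk m V ∧ h ≤ V m}.ncard = if h ≤ m then m.choose ((m - h) / 2) else 0 := by
  induction m generalizing h with
  | zero =>
    have key : {V | IsWalk 0 V ∧ h ≤ V 0} = if h = 0 then {fun _ => 0} else ∅ := by
      ext V
      split_ifs with hh
      · subst hh
        simp only [IsWalk, Set.mem_ofPred_eq, Set.mem_singleton_iff]
        constructor
        · rintro ⟨⟨h0, -, hz⟩, -⟩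
          funext t
          rcases Nat.eq_zero_or_pos t with rfl | ht
          · exact h0
          · exact hz t ht
        · rintro rfl
          simp
      · simp only [IsWalk, Set.mem_ofPred_eq, Set.mem_empty_iff_false, iff_false]
        omega
    rw [key]
    split_ifs <;> simp_all
  | succ m ih =>
    have hdisj : Disjoint
        ((fun V : ℕ → ℕ => Function.update V (m + 1) (V m + 1)) ''
          {V | IsWalk m V ∧ h - 1 ≤ V m})
        ((fun V : ℕ → ℕ => Function.update V (m + 1) (V m - 1)) ''
          {V | IsWalk m V ∧ h + 1 ≤ V m}) := by
      rw [Set.disjoint_left]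
      rintro _ ⟨V, -, rfl⟩ ⟨V', -, h'⟩
      have h1 := congrFun h' m
      have h2 := congrFun h' (m + 1)
      simp at h1 h2
      omega
    rw [setOf_isWalk_succ]
    have f1 := (ih (h - 1)).1
    have f2 := (ih (h + 1)).1
    refine ⟨(f1.image _).union (f2.image _), ?_⟩
    rw [Set.ncard_union_eq hdisj (f1.image _) (f2.image _),
      Set.InjOn.ncard_image ((injOn_update_isWalk m (· + 1)).mono fun V hV => hV.1),
      Set.InjOn.ncard_image ((injOn_update_isWalk m (· - 1)).mono fun V hV => hV.1),
      (ih _).2, (ih _).2]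
    by_cases h2 : h + 1 ≤ m
    · rw [if_pos (by omega), if_pos (by omega), if_pos (by omega)]
      rcases Nat.eq_zero_or_pos h with rfl | hpos
      · rcases Nat.even_or_odd' m with ⟨a, rfl | rfl⟩
        · obtain ⟨b, rfl⟩ : ∃ b, a = b + 1 := ⟨a - 1, by omega⟩
          rw [show (2 * (b + 1) - (0 - 1)) / 2 = b + 1 by omega,
            show (2 * (b + 1) - (0 + 1)) / 2 = b by omega,
            show (2 * (b + 1) + 1 - 0) / 2 = b + 1 by omega, Nat.choose_succ_succ', add_comm]
        · rw [show (2 * a + 1 - (0 - 1)) / 2 = a by omega,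
            show (2 * a + 1 - (0 + 1)) / 2 = a by omega,
            show (2 * a + 1 + 1 - 0) / 2 = a + 1 by omega, Nat.choose_succ_succ',
            Nat.choose_symm_half]
      · rw [show (m - (h - 1)) / 2 = (m - (h + 1)) / 2 + 1 by omega,
          show (m + 1 - h) / 2 = (m - (h + 1)) / 2 + 1 by omega, Nat.choose_succ_succ', add_comm]
    · rw [if_neg h2]
      by_cases h3 : h ≤ m + 1
      · rw [if_pos (by omega), if_pos h3, show (m - (h - 1)) / 2 = 0 by omega,
          show (m + 1 - h) / 2 = 0 by omega]
        simp
      · rw [if_neg (by omega), if_neg h3]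

/-- The positions `s` and `t` are at the same height of `W`, and `W` does not go below that
height between them. -/
def Visible (W : ℕ → ℕ) (s t : ℕ) : Prop :=
  W s = W t ∧ ∀ u, min s t ≤ u → u ≤ max s t → W s ≤ W u

theorem Visible.refl (W : ℕ → ℕ) (s : ℕ) : Visible W s s :=
  ⟨rfl, fun u h1 h2 => by rw [show u = s by omega]⟩

theorem Visible.symm {W : ℕ → ℕ} {s t : ℕ} (h : Visible W s t) : Visible W t s :=
  ⟨h.1.symm, fun u h1 h2 => h.1 ▸ h.2 u (by omega) (by omega)⟩

theorem Visible.trans {W : ℕ → ℕ} {r s t : ℕ} (h : Visible W r s) (h' : Visible W s t) :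
    Visible W r t := by
  refine ⟨h.1.trans h'.1, fun u h1 h2 => ?_⟩
  by_cases hu : min r s ≤ u ∧ u ≤ max r s
  · exact h.2 u hu.1 hu.2
  · rw [h.1]
    exact h'.2 u (by omega) (by omega)

theorem Visible.of_crossing {W : ℕ → ℕ} {a b c d : ℕ} (hab : a ≤ b) (hbc : b ≤ c) (hcd : c ≤ d)
    (hac : Visible W a c) (hbd : Visible W b d) : Visible W a b := by
  have h1 := hac.2 b (by omega) (by omega)
  have h2 := hbd.2 c (by omega) (by omega)
  have h3 := hac.1
  exact ⟨by omega, fun u hu hu' => hac.2 u (by omega) (by omega)⟩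

/-- The walk on `{0,…,2L}` that follows `V` up to time `L` and then retraces it backwards. -/
def mirror (L : ℕ) (V : ℕ → ℕ) (t : ℕ) : ℕ := V (min t (2 * L - t))

theorem mirror_of_le {L t : ℕ} (V : ℕ → ℕ) (h : t ≤ L) : mirror L V t = V t := by
  rw [mirror, min_eq_left (by omega)]

theorem mirror_sub {L t : ℕ} (V : ℕ → ℕ) (h : t ≤ 2 * L) :
    mirror L V (2 * L - t) = mirror L V t := by
  rw [mirror, mirror, min_comm]
  congr 2
  omega

theorem mirror_step {L : ℕ} {V : ℕ → ℕ} (hV : IsWalk L V) {t : ℕ} (ht : t < 2 * L) :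
    mirror L V (t + 1) = mirror L V t + 1 ∨ mirror L V (t + 1) + 1 = mirror L V t := by
  by_cases h : t < L
  · rw [mirror_of_le V h, mirror_of_le V h.le]
    exact hV.2.1 t h
  · rw [mirror, mirror, min_eq_right (by omega), min_eq_right (by omega)]
    have := hV.2.1 (2 * L - (t + 1)) (by omega)
    rw [show 2 * L - (t + 1) + 1 = 2 * L - t by omega] at this
    omega

theorem Visible.mirror {L s t : ℕ} {V : ℕ → ℕ} (hs : s ≤ 2 * L) (ht : t ≤ 2 * L)
    (h : Visible (mirror L V) s t) : Visible (mirror L V) (2 * L - s) (2 * L - t) := by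
  refine ⟨by rw [mirror_sub V hs, mirror_sub V ht, h.1], fun u h1 h2 => ?_⟩
  rw [mirror_sub V hs, ← mirror_sub V (show u ≤ 2 * L by omega)]
  exact h.2 _ (by omega) (by omega)

section Recovery

variable {L : ℕ} {W : ℕ → ℕ}

theorem mod_two_of_step (h0 : W 0 = 0)
    (hs : ∀ t < 2 * L, W (t + 1) = W t + 1 ∨ W (t + 1) + 1 = W t) {t : ℕ} (ht : t ≤ 2 * L) :
    W t % 2 = t % 2 := by
  induction t with
  | zero => rw [h0]
  | succ t ih =>
    have := ih (by omega)
    have := hs t (by omega)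
    omega

theorem step_down_iff (h0 : W 0 = 0)
    (hs : ∀ t < 2 * L, W (t + 1) = W t + 1 ∨ W (t + 1) + 1 = W t) {k : ℕ} (hk : k < L) :
    W (2 * k + 1) + 1 = W (2 * k) ↔ ∃ j < k, Visible W (2 * j + 1) (2 * k + 1) := by
  constructor
  · intro h
    have hP : W 0 ≤ W (2 * k + 1) := by omega
    have hle := Nat.findGreatest_le (P := fun s => W s ≤ W (2 * k + 1)) (2 * k)
    have hsp := Nat.findGreatest_spec (P := fun s => W s ≤ W (2 * k + 1)) (Nat.zero_le (2 * k)) hP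
    have hgr : ∀ u, Nat.findGreatest (fun s => W s ≤ W (2 * k + 1)) (2 * k) < u → u ≤ 2 * k →
        W (2 * k + 1) < W u := fun u h1 h2 => by
      simpa using Nat.findGreatest_is_greatest h1 h2
    generalize Nat.findGreatest (fun s => W s ≤ W (2 * k + 1)) (2 * k) = s at hle hsp hgr
    have hne : s ≠ 2 * k := by rintro rfl; omega
    have h1 := hgr (s + 1) (by omega) (by omega)
    have h2 := hs s (by omega)
    have h3 := mod_two_of_step h0 hs (show s ≤ 2 * L by omega)
    have h4 := mod_two_of_step h0 hs (show 2 * k + 1 ≤ 2 * L by omega)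
    obtain ⟨j, rfl⟩ : ∃ j, s = 2 * j + 1 := ⟨s / 2, by omega⟩
    refine ⟨j, by omega, by omega, fun u hu hu' => ?_⟩
    rcases eq_or_ne u (2 * j + 1) with rfl | hu1
    · rfl
    rcases eq_or_ne u (2 * k + 1) with rfl | hu2
    · omega
    have := hgr u (by omega) (by omega)
    omega
  · rintro ⟨j, hj, hv⟩
    have h1 := hv.2 (2 * k) (by omega) (by omega)
    have h2 := hv.1
    have h3 := hs (2 * k) (by omega)
    have h4 := mod_two_of_step h0 hs (show 2 * k ≤ 2 * L by omega)
    omega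

theorem step_up_iff (h0 : W 0 = 0) (hL : W (2 * L) = 0)
    (hs : ∀ t < 2 * L, W (t + 1) = W t + 1 ∨ W (t + 1) + 1 = W t) {k : ℕ} (hk : k < L) :
    W (2 * k + 2) = W (2 * k + 1) + 1 ↔
      ∃ j, k < j ∧ j < L ∧ Visible W (2 * j + 1) (2 * k + 1) := by
  constructor
  · intro h
    have hP : ∃ s, 2 * k + 2 ≤ s ∧ W s ≤ W (2 * k + 1) := ⟨2 * L, by omega, by omega⟩
    have hle : Nat.find hP ≤ 2 * L := Nat.find_min' hP ⟨by omega, by omega⟩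
    have hsp := Nat.find_spec hP
    have hgr : ∀ u, u < Nat.find hP → 2 * k + 2 ≤ u → W (2 * k + 1) < W u := fun u h1 h2 => by
      have := Nat.find_min hP h1
      omega
    generalize Nat.find hP = s at hle hsp hgr
    have hne : s ≠ 2 * k + 2 := by rintro rfl; omega
    have h1 := hgr (s - 1) (by omega) (by omega)
    have h2 := hs (s - 1) (by omega)
    rw [show s - 1 + 1 = s by omega] at h2
    have h3 := mod_two_of_step h0 hs (show s ≤ 2 * L by omega)
    have h4 := mod_two_of_step h0 hs (show 2 * k + 1 ≤ 2 * L by omega)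
    obtain ⟨j, rfl⟩ : ∃ j, s = 2 * j + 1 := ⟨s / 2, by omega⟩
    refine ⟨j, by omega, by omega, by omega, fun u hu hu' => ?_⟩
    rcases eq_or_ne u (2 * j + 1) with rfl | hu1
    · rfl
    rcases eq_or_ne u (2 * k + 1) with rfl | hu2
    · omega
    have := hgr u (by omega) (by omega)
    omega
  · rintro ⟨j, hj, hjL, hv⟩
    have h1 := hv.2 (2 * k + 2) (by omega) (by omega)
    have h2 := hv.1
    have h3 := hs (2 * k + 1) (by omega)
    rw [show 2 * k + 1 + 1 = 2 * k + 2 by omega] at h3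
    omega

end Recovery

theorem IsWalk.ext_of_visible {L : ℕ} {V V' : ℕ → ℕ} (hV : IsWalk L V) (hV' : IsWalk L V')
    (h : ∀ i < L, ∀ j < L, Visible (mirror L V) (2 * i + 1) (2 * j + 1) ↔
      Visible (mirror L V') (2 * i + 1) (2 * j + 1)) : V = V' := by
  have h0 : ∀ {U}, IsWalk L U → mirror L U 0 = 0 := fun hU => by
    rw [mirror_of_le _ (Nat.zero_le L), hU.1]
  have hL : ∀ {U}, IsWalk L U → mirror L U (2 * L) = 0 := fun {U} hU => by
    simpa [h0 hU] using mirror_sub (L := L) U (Nat.zero_le (2 * L))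
  have key : ∀ t ≤ 2 * L, mirror L V t = mirror L V' t := by
    intro t
    induction t with
    | zero => intro; rw [h0 hV, h0 hV']
    | succ t ih =>
      intro ht
      have e := ih (by omega)
      have s := mirror_step hV (show t < 2 * L by omega)
      have s' := mirror_step hV' (show t < 2 * L by omega)
      rcases Nat.even_or_odd' t with ⟨k, rfl | rfl⟩
      · have hk : k < L := by omega
        have d := step_down_iff (h0 hV) (fun t => mirror_step hV) hk
        have d' := step_down_iff (h0 hV') (fun t => mirror_step hV') hk
        have : (∃ j < k, Visible (mirror L V) (2 * j + 1) (2 * k + 1)) ↔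
            ∃ j < k, Visible (mirror L V') (2 * j + 1) (2 * k + 1) :=
          exists_congr fun j => and_congr_right fun hj => h j (by omega) k hk
        rw [← d, ← d'] at this
        omega
      · have hk : k < L := by omega
        have d := step_up_iff (h0 hV) (hL hV) (fun t => mirror_step hV) hk
        have d' := step_up_iff (h0 hV') (hL hV') (fun t => mirror_step hV') hk
        have : (∃ j, k < j ∧ j < L ∧ Visible (mirror L V) (2 * j + 1) (2 * k + 1)) ↔
            ∃ j, k < j ∧ j < L ∧ Visible (mirror L V') (2 * j + 1) (2 * k + 1) :=
          exists_congr fun j => and_congr_right fun hj => and_congr_right fun hj' =>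
            h j hj' k hk
        rw [← d, ← d'] at this
        rw [show 2 * k + 1 + 1 = 2 * k + 2 by omega] at s s' ⊢
        omega
  funext t
  by_cases ht : t ≤ L
  · simpa only [mirror_of_le _ ht] using key t (by omega)
  · rw [hV.2.2 t (by omega), hV'.2.2 t (by omega)]

section Partition

variable {L : ℕ} {P : Finpartition (Finset.univ : Finset (Fin L))}

theorem mem_part_iff {i j : Fin L} : i ∈ P.part j ↔ P.part i = P.part j :=
  P.mem_part_iff_part_eq_part (mem_univ _) (mem_univ _)

theorem mem_parts_iff {B : Finset (Fin L)} : B ∈ P.parts ↔ ∃ i, P.part i = B := by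
  constructor
  · intro hB
    obtain ⟨i, hi⟩ := P.nonempty_of_mem_parts hB
    exact ⟨i, P.part_eq_of_mem hB hi⟩
  · rintro ⟨i, rfl⟩
    exact P.part_mem.2 (mem_univ i)

theorem Finpartition.ext_of_part_eq_iff {Q : Finpartition (Finset.univ : Finset (Fin L))}
    (h : ∀ i j, P.part i = P.part j ↔ Q.part i = Q.part j) : P = Q := by
  have hpart : ∀ i, P.part i = Q.part i := fun i => by
    ext j
    rw [mem_part_iff, mem_part_iff, h]
  ext B
  simp_rw [mem_parts_iff, hpart]

theorem nonCrossing_iff : NonCrossing P ↔ ∀ a b c d : Fin L, a < b → b < c → c < d →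
    P.part a = P.part c → P.part b = P.part d → P.part a = P.part b := by
  constructor
  · intro h a b c d hab hbc hcd hac hbd
    by_contra hne
    exact h ⟨a, b, c, d, hab, hbc, hcd, P.part a, mem_parts_iff.2 ⟨a, rfl⟩, P.part b,
      mem_parts_iff.2 ⟨b, rfl⟩, hne, mem_part_iff.2 rfl, mem_part_iff.2 hac.symm,
      mem_part_iff.2 rfl, mem_part_iff.2 hbd.symm⟩
  · rintro h ⟨a, b, c, d, hab, hbc, hcd, B₁, h₁, B₂, h₂, hne, ha, hc, hb, hd⟩
    rw [← P.part_eq_iff_mem h₁] at ha hc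
    rw [← P.part_eq_iff_mem h₂] at hb hd
    exact hne (ha ▸ hb ▸ h a b c d hab hbc hcd (ha.trans hc.symm) (hb.trans hd.symm))

theorem reflParts_eq_iff : reflParts P = P.parts ↔
    ∀ i j, P.part i = P.part j → P.part i.rev = P.part j.rev := by
  constructor
  · intro h i j hij
    have hB : (P.part i).image Fin.rev ∈ P.parts := by
      rw [← h]
      exact mem_image_of_mem _ (mem_parts_iff.2 ⟨i, rfl⟩)
    rw [P.part_eq_of_mem hB (mem_image_of_mem _ (mem_part_iff.2 rfl)),
      P.part_eq_of_mem hB (mem_image_of_mem _ (mem_part_iff.2 hij.symm))]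
  · intro h
    have himage : ∀ i, (P.part i).image Fin.rev = P.part i.rev := fun i => by
      ext j
      rw [mem_image, mem_part_iff]
      constructor
      · rintro ⟨k, hk, rfl⟩
        exact h _ _ (mem_part_iff.1 hk)
      · intro hj
        refine ⟨j.rev, mem_part_iff.2 ?_, Fin.rev_rev j⟩
        simpa using h _ _ hj
    ext B
    rw [reflParts, mem_image]
    constructor
    · rintro ⟨C, hC, rfl⟩
      obtain ⟨i, rfl⟩ := mem_parts_iff.1 hC
      exact mem_parts_iff.2 ⟨i.rev, (himage i).symm⟩
    · intro hB
      obtain ⟨i, rfl⟩ := mem_parts_iff.1 hB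
      exact ⟨P.part i.rev, mem_parts_iff.2 ⟨_, rfl⟩, by rw [himage, Fin.rev_rev]⟩

/-- The blocks of `P` that have elements on both sides of `t` and avoid `t`, where `x : Fin L`
is placed at the position `2 * x + 1`. -/
def covering (P : Finpartition (Finset.univ : Finset (Fin L))) (t : ℕ) :
    Finset (Finset (Fin L)) :=
  P.parts.filter fun B => (∃ x ∈ B, 2 * x.val + 1 < t) ∧ (∃ x ∈ B, t < 2 * x.val + 1) ∧
    ∀ x ∈ B, 2 * x.val + 1 ≠ t

/-- The height function of `P`: it is determined by the number of blocks covering `t`. -/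
def coveringHeight (P : Finpartition (Finset.univ : Finset (Fin L))) (t : ℕ) : ℕ :=
  2 * #(covering P t) + t % 2

theorem mem_covering {B : Finset (Fin L)} {t : ℕ} : B ∈ covering P t ↔ B ∈ P.parts ∧
    (∃ x ∈ B, 2 * x.val + 1 < t) ∧ (∃ x ∈ B, t < 2 * x.val + 1) ∧
    ∀ x ∈ B, 2 * x.val + 1 ≠ t := mem_filter

theorem part_notMem_covering (k : Fin L) : P.part k ∉ covering P (2 * k + 1) := fun h =>
  (mem_covering.1 h).2.2.2 k (mem_part_iff.2 rfl) rfl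

theorem covering_subset_of_adjacent {k : Fin L} {s : ℕ} (hs : s = 2 * k ∨ s = 2 * k + 2) :
    covering P (2 * k + 1) ⊆ covering P s := by
  intro B hB
  obtain ⟨hBP, ⟨x, hx, hx'⟩, ⟨y, hy, hy'⟩, hz⟩ := mem_covering.1 hB
  exact mem_covering.2 ⟨hBP, ⟨x, hx, by omega⟩, ⟨y, hy, by omega⟩, fun z _ => by omega⟩

theorem eq_part_of_mem_covering_of_adjacent {k : Fin L} {s : ℕ} (hs : s = 2 * k ∨ s = 2 * k + 2)
    {B : Finset (Fin L)} (hB : B ∈ covering P s) (hB' : B ∉ covering P (2 * k + 1)) :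
    B = P.part k := by
  obtain ⟨hBP, ⟨x, hx, hx'⟩, ⟨y, hy, hy'⟩, hz⟩ := mem_covering.1 hB
  symm
  rw [P.part_eq_iff_mem hBP]
  by_contra hk
  have hne : ∀ z ∈ B, z.val ≠ k.val := fun z hz h => hk (Fin.ext h ▸ hz)
  have := hne x hx
  have := hne y hy
  exact hB' (mem_covering.2 ⟨hBP, ⟨x, hx, by omega⟩, ⟨y, hy, by omega⟩, fun z hz => by
    have := hne z hz
    omega⟩)

theorem card_covering_of_adjacent {k : Fin L} {s : ℕ} (hs : s = 2 * k ∨ s = 2 * k + 2) :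
    #(covering P s) = #(covering P (2 * k + 1)) ∨
      #(covering P s) = #(covering P (2 * k + 1)) + 1 := by
  have hsub := covering_subset_of_adjacent (P := P) hs
  by_cases hk : P.part k ∈ covering P s
  · right
    rw [← card_insert_of_notMem (part_notMem_covering k)]
    congr 1
    ext B
    rw [mem_insert]
    constructor
    · intro hB
      by_cases hB' : B ∈ covering P (2 * k + 1)
      · exact Or.inr hB'
      · exact Or.inl (eq_part_of_mem_covering_of_adjacent hs hB hB')
    · rintro (rfl | hB)
      · exact hk
      · exact hsub hB
  · left
    congr 1
    refine (hsub.antisymm fun B hB => ?_).symm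
    by_contra hB'
    exact hk (eq_part_of_mem_covering_of_adjacent hs hB hB' ▸ hB)

theorem coveringHeight_step {t : ℕ} (ht : t < 2 * L) :
    coveringHeight P (t + 1) = coveringHeight P t + 1 ∨
      coveringHeight P (t + 1) + 1 = coveringHeight P t := by
  unfold coveringHeight
  rcases Nat.even_or_odd' t with ⟨k, rfl | rfl⟩
  · have := card_covering_of_adjacent (P := P) (k := ⟨k, by omega⟩) (Or.inl rfl)
    simp only at this
    omega
  · have := card_covering_of_adjacent (P := P) (k := ⟨k, by omega⟩) (Or.inr rfl)
    simp only at this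
    rw [show 2 * k + 1 + 1 = 2 * k + 2 by omega]
    omega

theorem coveringHeight_zero : coveringHeight P 0 = 0 := by
  have : covering P 0 = ∅ := eq_empty_of_forall_notMem fun B hB => by
    obtain ⟨-, ⟨x, -, hx⟩, -⟩ := mem_covering.1 hB
    omega
  rw [coveringHeight, this]
  rfl

theorem image_rev_mem_covering (h : reflParts P = P.parts) {t : ℕ} (ht : t ≤ 2 * L)
    {B : Finset (Fin L)} (hB : B ∈ covering P t) :
    B.image Fin.rev ∈ covering P (2 * L - t) := by
  obtain ⟨hBP, ⟨x, hx, hx'⟩, ⟨y, hy, hy'⟩, hz⟩ := mem_covering.1 hB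
  refine mem_covering.2 ⟨h ▸ mem_image_of_mem _ hBP, ⟨y.rev, mem_image_of_mem _ hy, ?_⟩,
    ⟨x.rev, mem_image_of_mem _ hx, ?_⟩, fun w hw => ?_⟩
  · rw [Fin.val_rev]; omega
  · rw [Fin.val_rev]; omega
  · obtain ⟨z, hzB, rfl⟩ := mem_image.1 hw
    have := hz z hzB
    rw [Fin.val_rev]; omega

theorem card_covering_le_sub (h : reflParts P = P.parts) {t : ℕ} (ht : t ≤ 2 * L) :
    #(covering P t) ≤ #(covering P (2 * L - t)) :=
  card_le_card_of_injOn (fun B => B.image Fin.rev) (fun _ => image_rev_mem_covering h ht)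
    (image_injective Fin.rev_injective).injOn

theorem coveringHeight_sub (h : reflParts P = P.parts) {t : ℕ} (ht : t ≤ 2 * L) :
    coveringHeight P (2 * L - t) = coveringHeight P t := by
  have h1 := card_covering_le_sub h ht
  have h2 := card_covering_le_sub h (Nat.sub_le (2 * L) t)
  rw [Nat.sub_sub_self ht] at h2
  unfold coveringHeight
  omega

/-- In a non-crossing partition, a block other than that of `i` and `j` with an element outside
`[i, j]` has no element between `i` and `j`. -/
theorem NonCrossing.not_between (hP : NonCrossing P) {i j x y : Fin L}
    (hp : P.part i = P.part j) (hxi : P.part x ≠ P.part i) (hxy : P.part x = P.part y)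
    (hx : x < i ∨ j < x) : ¬ (i < y ∧ y < j) := by
  rintro ⟨hiy, hyj⟩
  rw [nonCrossing_iff] at hP
  rcases hx with hx | hx
  · exact hxi (hP x i y j hx hiy hyj hxy hp)
  · exact hxi (hxy.trans (hP i y j x hiy hyj hx hp hxy.symm).symm)

theorem NonCrossing.lt_or_lt_of_mem_covering (hP : NonCrossing P) {i j : Fin L} (hij : i < j)
    (hp : P.part i = P.part j) {C : Finset (Fin L)}
    (hC : C ∈ covering P (2 * i + 1) ∨ C ∈ covering P (2 * j + 1)) :
    ∀ z ∈ C, z < i ∨ j < z := by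
  have key : ∃ x ∈ C, (x < i ∨ j < x) ∧ P.part x ≠ P.part i := by
    rcases hC with hC | hC
    · obtain ⟨hCP, ⟨x, hx, hx'⟩, -, hz⟩ := mem_covering.1 hC
      refine ⟨x, hx, Or.inl (by omega), fun h => ?_⟩
      rw [P.part_eq_of_mem hCP hx, eq_comm, P.part_eq_iff_mem hCP] at h
      exact hz i h rfl
    · obtain ⟨hCP, -, ⟨x, hx, hx'⟩, hz⟩ := mem_covering.1 hC
      refine ⟨x, hx, Or.inr (by omega), fun h => ?_⟩
      rw [P.part_eq_of_mem hCP hx, hp, eq_comm, P.part_eq_iff_mem hCP] at h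
      exact hz j h rfl
  obtain ⟨x, hx, hx', hne⟩ := key
  have hCP : C ∈ P.parts := by
    rcases hC with hC | hC <;> exact (mem_covering.1 hC).1
  intro z hz
  have hxz : P.part x = P.part z := by rw [P.part_eq_of_mem hCP hx, P.part_eq_of_mem hCP hz]
  have h1 := hP.not_between hp hne hxz hx'
  have h2 : z ≠ i := by rintro rfl; exact hne hxz
  have h3 : z ≠ j := by rintro rfl; exact hne (hxz.trans hp.symm)
  omega

theorem NonCrossing.mem_covering_of_between (hP : NonCrossing P) {i j : Fin L} (hij : i < j)
    (hp : P.part i = P.part j) {C : Finset (Fin L)}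
    (hC : C ∈ covering P (2 * i + 1) ∨ C ∈ covering P (2 * j + 1)) {u : ℕ}
    (hiu : 2 * i.val + 1 ≤ u) (huj : u ≤ 2 * j.val + 1) : C ∈ covering P u := by
  have hz := hP.lt_or_lt_of_mem_covering hij hp hC
  have key : C ∈ P.parts ∧ (∃ x ∈ C, x < i) ∧ ∃ y ∈ C, j < y := by
    rcases hC with hC | hC
    · obtain ⟨hCP, ⟨x, hx, hx'⟩, ⟨y, hy, hy'⟩, -⟩ := mem_covering.1 hC
      exact ⟨hCP, ⟨x, hx, by omega⟩, y, hy, (hz y hy).resolve_left (by omega)⟩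
    · obtain ⟨hCP, ⟨x, hx, hx'⟩, ⟨y, hy, hy'⟩, -⟩ := mem_covering.1 hC
      exact ⟨hCP, ⟨x, hx, (hz x hx).resolve_right (by omega)⟩, y, hy, by omega⟩
  obtain ⟨hCP, ⟨x, hx, hx'⟩, y, hy, hy'⟩ := key
  exact mem_covering.2 ⟨hCP, ⟨x, hx, by omega⟩, ⟨y, hy, by omega⟩, fun z hzC => by
    have := hz z hzC
    omega⟩

theorem NonCrossing.visible_of_part_eq_of_lt (hP : NonCrossing P) {i j : Fin L} (hij : i < j)
    (hp : P.part i = P.part j) : Visible (coveringHeight P) (2 * i + 1) (2 * j + 1) := by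
  constructor
  · have : covering P (2 * i + 1) = covering P (2 * j + 1) := by
      ext C
      exact ⟨fun hC => hP.mem_covering_of_between hij hp (Or.inl hC) (by omega) (by omega),
        fun hC => hP.mem_covering_of_between hij hp (Or.inr hC) (by omega) (by omega)⟩
    unfold coveringHeight
    rw [this]
    omega
  · intro u hu hu'
    have hsub : covering P (2 * i + 1) ⊆ covering P u := fun C hC =>
      hP.mem_covering_of_between hij hp (Or.inl hC) (by omega) (by omega)
    have hle := card_le_card hsub
    unfold coveringHeight
    rcases Nat.even_or_odd' u with ⟨k, rfl | rfl⟩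
    · have hi : P.part i ∈ covering P (2 * k) :=
        mem_covering.2 ⟨mem_parts_iff.2 ⟨i, rfl⟩, ⟨i, mem_part_iff.2 rfl, by omega⟩,
          ⟨j, mem_part_iff.2 hp.symm, by omega⟩, fun z _ => by omega⟩
      have := card_le_card (insert_subset hi hsub)
      rw [card_insert_of_notMem (part_notMem_covering i)] at this
      omega
    · omega

theorem NonCrossing.visible_of_part_eq (hP : NonCrossing P) {i j : Fin L}
    (hp : P.part i = P.part j) : Visible (coveringHeight P) (2 * i + 1) (2 * j + 1) := by
  rcases lt_trichotomy i j with h | rfl | h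
  · exact hP.visible_of_part_eq_of_lt h hp
  · exact Visible.refl _ _
  · exact (hP.visible_of_part_eq_of_lt h hp.symm).symm

theorem NonCrossing.part_eq_of_visible_of_lt (hP : NonCrossing P) {i j : Fin L} (hij : i < j)
    (hv : Visible (coveringHeight P) (2 * i + 1) (2 * j + 1)) : P.part i = P.part j := by
  by_contra hne
  obtain ⟨k, hk, hmax⟩ := ((P.part i).filter (· < j)).exists_max_image id
    ⟨i, mem_filter.2 ⟨mem_part_iff.2 rfl, hij⟩⟩
  rw [mem_filter, mem_part_iff] at hk
  obtain ⟨hki, hkj⟩ := hk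
  replace hv := (hP.visible_of_part_eq hki).trans hv
  have hup := hv.2 (2 * k + 2) (by omega) (by omega)
  have hex : ¬ covering P (2 * k + 2) ⊆ covering P (2 * k + 1) := fun h => by
    have := card_le_card h
    unfold coveringHeight at hup
    omega
  obtain ⟨B, hB, hB'⟩ := not_subset.1 hex
  obtain rfl := eq_part_of_mem_covering_of_adjacent (Or.inr rfl) hB hB'
  obtain ⟨-, -, ⟨e, he, hke⟩, -⟩ := mem_covering.1 hB
  rw [mem_part_iff] at he
  have hje : j < e := by
    rcases lt_trichotomy e j with h | rfl | h
    · have : e ≤ k := hmax e (mem_filter.2 ⟨mem_part_iff.2 (he.trans hki), h⟩)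
      omega
    · exact absurd (he.trans hki).symm hne
    · exact h
  have hk : P.part k ∈ covering P (2 * j + 1) :=
    mem_covering.2 ⟨mem_parts_iff.2 ⟨k, rfl⟩, ⟨k, mem_part_iff.2 rfl, by omega⟩,
      ⟨e, mem_part_iff.2 he, by omega⟩, fun z hz h => hne (by
        obtain rfl : z = j := by omega
        exact ((mem_part_iff.1 hz).trans hki).symm)⟩
  have hsub : covering P (2 * k + 1) ⊆ covering P (2 * j + 1) := fun C hC =>
    hP.mem_covering_of_between (hkj.trans hje) he.symm (Or.inl hC) (by omega) (by omega)
  have hcard := card_le_card (insert_subset hk hsub)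
  rw [card_insert_of_notMem (part_notMem_covering k)] at hcard
  have heq := hv.1
  unfold coveringHeight at heq
  omega

theorem NonCrossing.part_eq_iff_visible (hP : NonCrossing P) {i j : Fin L} :
    P.part i = P.part j ↔ Visible (coveringHeight P) (2 * i + 1) (2 * j + 1) := by
  refine ⟨hP.visible_of_part_eq, fun hv => ?_⟩
  rcases lt_trichotomy i j with h | rfl | h
  · exact hP.part_eq_of_visible_of_lt h hv
  · rfl
  · exact (hP.part_eq_of_visible_of_lt h hv.symm).symm

end Partition

/-- The equivalence relation on `Fin L` relating `i` and `j` when the positions `2 * i + 1` and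
`2 * j + 1` of the mirrored walk see each other. -/
def walkSetoid (L : ℕ) (V : ℕ → ℕ) : Setoid (Fin L) where
  r i j := Visible (mirror L V) (2 * i + 1) (2 * j + 1)
  iseqv := ⟨fun _ => Visible.refl _ _, Visible.symm, Visible.trans⟩

open Classical in
/-- The partition of `Fin L` into the classes of `walkSetoid`. -/
noncomputable def walkPartition (L : ℕ) (V : ℕ → ℕ) :
    Finpartition (Finset.univ : Finset (Fin L)) :=
  Finpartition.ofSetoid (walkSetoid L V)

theorem walkPartition_part_eq_iff {L : ℕ} {V : ℕ → ℕ} {i j : Fin L} :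
    (walkPartition L V).part i = (walkPartition L V).part j ↔
      Visible (mirror L V) (2 * i + 1) (2 * j + 1) := by
  classical
  rw [← mem_part_iff, walkPartition]
  exact Finpartition.mem_part_ofSetoid_iff_rel.trans ⟨Visible.symm, Visible.symm⟩

theorem nonCrossing_walkPartition (L : ℕ) (V : ℕ → ℕ) : NonCrossing (walkPartition L V) := by
  simp_rw [nonCrossing_iff, walkPartition_part_eq_iff]
  intro a b c d hab hbc hcd hac hbd
  exact Visible.of_crossing (by omega) (by omega) (by omega) hac hbd

theorem reflParts_walkPartition (L : ℕ) (V : ℕ → ℕ) :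
    reflParts (walkPartition L V) = (walkPartition L V).parts := by
  simp_rw [reflParts_eq_iff, walkPartition_part_eq_iff]
  intro i j h
  have := h.mirror (by omega) (by omega)
  rw [Fin.val_rev, Fin.val_rev]
  convert this using 1 <;> omega

theorem injOn_walkPartition (L : ℕ) : Set.InjOn (walkPartition L) {V | IsWalk L V} := by
  intro V hV V' hV' h
  refine IsWalk.ext_of_visible hV hV' fun i hi j hj => ?_
  have key : (walkPartition L V).part ⟨i, hi⟩ = (walkPartition L V).part ⟨j, hj⟩ ↔
      (walkPartition L V').part ⟨i, hi⟩ = (walkPartition L V').part ⟨j, hj⟩ := by rw [h]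
  rwa [walkPartition_part_eq_iff, walkPartition_part_eq_iff] at key

theorem exists_walkPartition_eq {L : ℕ} {P : Finpartition (Finset.univ : Finset (Fin L))}
    (hP : NonCrossing P) (hr : reflParts P = P.parts) : ∃ V, IsWalk L V ∧ walkPartition L V = P := by
  refine ⟨fun t => if t ≤ L then coveringHeight P t else 0, ⟨?_, fun t ht => ?_, fun t ht => ?_⟩,
    Finpartition.ext_of_part_eq_iff fun i j => ?_⟩
  · simp [coveringHeight_zero]
  · simp only [show t + 1 ≤ L by omega, show t ≤ L by omega, if_true]
    exact coveringHeight_step (by omega)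
  · exact if_neg (by omega)
  · have hm : ∀ t ≤ 2 * L, mirror L (fun t => if t ≤ L then coveringHeight P t else 0) t =
        coveringHeight P t := fun t ht => by
      rw [mirror, if_pos (by omega)]
      rcases le_total t (2 * L - t) with h | h
      · rw [min_eq_left h]
      · rw [min_eq_right h, coveringHeight_sub hr ht]
    rw [walkPartition_part_eq_iff, hP.part_eq_iff_visible, Visible, Visible,
      hm _ (by omega), hm _ (by omega)]
    refine and_congr_right fun _ => forall_congr' fun u => forall_congr' fun _ =>
      forall_congr' fun hu => ?_
    rw [hm u (by omega)]

/-- For every even positive integer `L`, the number of non-crossing partitions of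
`{1,…,L}` fixed by the reflection `τ(i) = L+1−i` (i.e. `τ·P = P`) equals
`binom(L, L/2)`. -/
theorem noncrossing_reflection_fixed_count (L : ℕ) (hL : 0 < L) (hE : Even L) :
    {P : Finpartition (Finset.univ : Finset (Fin L)) |
        NonCrossing P ∧ reflParts P = P.parts}.ncard
      = Nat.choose L (L / 2) := by
  have himage : {P : Finpartition (Finset.univ : Finset (Fin L)) |
      NonCrossing P ∧ reflParts P = P.parts} =
        walkPartition L '' {V | IsWalk L V ∧ 0 ≤ V L} := by
    ext P
    constructor
    · rintro ⟨hP, hr⟩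
      obtain ⟨V, hV, rfl⟩ := exists_walkPartition_eq hP hr
      exact ⟨V, ⟨hV, Nat.zero_le _⟩, rfl⟩
    · rintro ⟨V, -, rfl⟩
      exact ⟨nonCrossing_walkPartition L V, reflParts_walkPartition L V⟩
  rw [himage, Set.InjOn.ncard_image ((injOn_walkPartition L).mono fun V hV => hV.1),
    (finite_and_ncard_isWalk L 0).2, if_pos (Nat.zero_le L), Nat.sub_zero]
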